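/- arXiv:1908.11777 — 3 statements merged into one kernel-verified Lean document; each statement's English description precedes it below -/
import Mathlib

section
/- Let n ≥ 1 be an integer, let ξ ∈ ℝ^{n+1} have ℚ-linearly independent coordinates, and assume the setup of the functional transference theorem: S ⊆ ℤ^{n+1}, I an unbounded subinterval of (0,∞), A ∈ I, and continuous functions φ, ψ, θ : I → (0,∞) satisfying conditions (i)–(v). Then the functions Φ_0, Φ_1, …, Φ_{n−2} are all monotonically increasing on [A,∞). -/
open Filter

/-- Euclidean norm of an integer point of `ℤ^{n+1}`. -/
noncomputable def inorm {n : ℕ} (x : Fin (n + 1) → ℤ) : ℝ :=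
  Real.sqrt (∑ k, ((x k : ℝ)) ^ 2)

/-- `L_ξ(x) = max_{1 ≤ k ≤ n} |ξ₀ x_k − ξ_k x₀|` (the term `k = 0` vanishes, so the
maximum over all `k` agrees with the maximum over `1 ≤ k ≤ n` when `n ≥ 1`). -/
noncomputable def Lxi {n : ℕ} (ξ : Fin (n + 1) → ℝ) (x : Fin (n + 1) → ℤ) : ℝ :=
  Finset.univ.sup' Finset.univ_nonempty fun k => |ξ 0 * (x k : ℝ) - ξ k * (x 0 : ℝ)|

/-- `𝓛_ξ(X; S) = min { L_ξ(x) : x ∈ S, 0 < ‖x‖ ≤ X }`, with the convention `min ∅ = ∞`. -/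
noncomputable def calL {n : ℕ} (ξ : Fin (n + 1) → ℝ) (S : Set (Fin (n + 1) → ℤ)) (X : ℝ) :
    ENNReal :=
  sInf { l | ∃ x ∈ S, x ≠ 0 ∧ inorm x ≤ X ∧ l = ENNReal.ofReal (Lxi ξ x) }

/-- `Φ_k(X) = X · φ(θ^k(X)) ⋯ φ(θ(X)) φ(X)` (so that `Φ_0(X) = X φ(X)`). -/
noncomputable def PhiFun (φ θ : ℝ → ℝ) (k : ℕ) (X : ℝ) : ℝ :=
  X * ∏ j ∈ Finset.range (k + 1), φ (θ^[j] X)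

/-- The real vector with the coordinates of an integer vector. -/
def realVec {N : ℕ} (x : Fin N → ℤ) : Fin N → ℝ := fun k => (x k : ℝ)

/-- The subspace `V` has a basis of `m` integer vectors whose maximal minors are at most `B`. -/
def HasMinorBound {N : ℕ} (m : ℕ) (V : Submodule ℝ (Fin N → ℝ)) (B : ℝ) : Prop :=
  ∃ y : Fin m → Fin N → ℤ, LinearIndependent ℝ (fun i => realVec (y i)) ∧
    Submodule.span ℝ (Set.range fun i => realVec (y i)) = V ∧
    ∀ σ : Fin m → Fin N, |((Matrix.of fun i j => y i (σ j)).det : ℝ)| ≤ B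

lemma HasMinorBound.mono {N m : ℕ} {V : Submodule ℝ (Fin N → ℝ)} {B B' : ℝ}
    (h : HasMinorBound m V B) (hB : B ≤ B') : HasMinorBound m V B' := by
  obtain ⟨y, h1, h2, h3⟩ := h
  exact ⟨y, h1, h2, fun σ => (h3 σ).trans hB⟩

lemma hasMinorBound_bot {N : ℕ} : HasMinorBound 0 (⊥ : Submodule ℝ (Fin N → ℝ)) 1 :=
  ⟨Fin.elim0, linearIndependent_empty_type, by simp, by simp⟩

/-- Every subspace with an integer basis satisfies some bound. -/
lemma exists_hasMinorBound {N m : ℕ} (y : Fin m → Fin N → ℤ)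
    (hy : LinearIndependent ℝ fun i => realVec (y i)) :
    ∃ B, HasMinorBound m (Submodule.span ℝ (Set.range fun i => realVec (y i))) B := by
  obtain ⟨B, hB⟩ := (Set.finite_range fun σ : Fin m → Fin N =>
    |((Matrix.of fun i j => y i (σ j)).det : ℝ)|).bddAbove
  exact ⟨B, y, hy, rfl, fun σ => hB ⟨σ, rfl⟩⟩

/-- Vectors in the span of `y` annihilate the expansion of a minor along an extra row. -/
lemma sum_minors_eq_zero {N m : ℕ} (y : Fin m → Fin N → ℤ) (σ : Fin (m + 1) → Fin N)
    {u : Fin N → ℝ} (hu : u ∈ Submodule.span ℝ (Set.range fun i => realVec (y i))) :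
    ∑ j : Fin (m + 1), (-1) ^ (j : ℕ) * u (σ j) *
      ((Matrix.of fun i k => y i (σ (j.succAbove k))).det : ℝ) = 0 := by
  set M : Matrix (Fin (m + 1)) (Fin (m + 1)) ℝ :=
    fun i j => (Fin.cons u (fun i => realVec (y i)) : Fin (m + 1) → Fin N → ℝ) i (σ j) with hM
  have h0 : M.det = 0 := by
    apply Matrix.det_eq_zero_of_not_linearIndependent_rows
    intro h
    have h' : LinearIndependent ℝ ((LinearMap.funLeft ℝ ℝ σ) ∘
      (Fin.cons u (fun i => realVec (y i)) : Fin (m + 1) → Fin N → ℝ)) := h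
    exact (linearIndependent_finCons.1 h'.of_comp).2 hu
  rw [Matrix.det_succ_row_zero] at h0
  rw [← h0]
  refine Finset.sum_congr rfl fun j _ => ?_
  have : ((Matrix.of fun i k => y i (σ (j.succAbove k))).det : ℝ)
      = (M.submatrix Fin.succ j.succAbove).det := by
    rw [Int.cast_det]
    rfl
  rw [this]
  simp [hM]

lemma det_cons_eq_sum {N m : ℕ} (x : Fin N → ℤ) (y : Fin m → Fin N → ℤ)
    (σ : Fin (m + 1) → Fin N) :
    (Matrix.of fun i j => (Fin.cons x y : Fin (m + 1) → Fin N → ℤ) i (σ j)).det =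
      ∑ j : Fin (m + 1), (-1) ^ (j : ℕ) * x (σ j) * (Matrix.of fun i k => y i (σ (j.succAbove k))).det := by
  rw [Matrix.det_succ_row_zero]
  rfl

lemma HasMinorBound.sup_span {N m : ℕ} {V : Submodule ℝ (Fin N → ℝ)} {B r : ℝ}
    (h : HasMinorBound m V B) (x : Fin N → ℤ) (u : Fin N → ℝ) (hu : u ∈ V)
    (hr : 0 ≤ r) (hxu : ∀ k, |(x k : ℝ) - u k| ≤ r) (hx : realVec x ∉ V) :
    HasMinorBound (m + 1) (V ⊔ Submodule.span ℝ {realVec x}) ((m + 1) * (r * B)) := by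
  obtain ⟨y, hy, rfl, hB⟩ := h
  have hcons : (fun i => realVec ((Fin.cons x y : Fin (m + 1) → Fin N → ℤ) i)) =
      (Fin.cons (realVec x) (fun i => realVec (y i)) : Fin (m + 1) → Fin N → ℝ) := by
    funext i
    refine Fin.cases rfl (fun i => rfl) i
  refine ⟨Fin.cons x y, ?_, ?_, fun σ => ?_⟩
  · rw [hcons]
    exact linearIndependent_finCons.2 ⟨hy, hx⟩
  · rw [hcons, Fin.range_cons, Submodule.span_insert, sup_comm]
  · have h1 : ((Matrix.of fun i j =>
        (Fin.cons x y : Fin (m + 1) → Fin N → ℤ) i (σ j)).det : ℝ) =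
        ∑ j : Fin (m + 1), (-1) ^ (j : ℕ) * ((x (σ j) : ℝ) - u (σ j)) *
          ((Matrix.of fun i k => y i (σ (j.succAbove k))).det : ℝ) := by
      rw [det_cons_eq_sum]
      simp only [Int.cast_sum, Int.cast_mul, Int.cast_pow, Int.cast_neg, Int.cast_one]
      rw [← sub_zero (∑ _, _), ← sum_minors_eq_zero y σ hu, ← Finset.sum_sub_distrib]
      exact Finset.sum_congr rfl fun j _ => by ring
    rw [h1]
    refine (Finset.abs_sum_le_sum_abs _ _).trans ?_
    have h2 : ∀ j ∈ (Finset.univ : Finset (Fin (m + 1))),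
        |(-1) ^ (j : ℕ) * ((x (σ j) : ℝ) - u (σ j)) *
          ((Matrix.of fun i k => y i (σ (j.succAbove k))).det : ℝ)| ≤ r * B := by
      intro j _
      rw [abs_mul, abs_mul, abs_pow, abs_neg, abs_one, one_pow, one_mul]
      exact mul_le_mul (hxu _) (hB fun k => σ (j.succAbove k)) (abs_nonneg _) hr
    refine (Finset.sum_le_card_nsmul _ _ _ h2).trans (le_of_eq ?_)
    simp

/-- A family of linearly independent vectors has a nonzero maximal minor. -/
lemma exists_minor_ne_zero {N m : ℕ} (y : Fin m → Fin N → ℤ)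
    (hy : LinearIndependent ℝ fun i => realVec (y i)) :
    ∃ σ : Fin m → Fin N, Function.Injective σ ∧ (Matrix.of fun i j => y i (σ j)).det ≠ 0 := by
  set M : Matrix (Fin m) (Fin N) ℝ := fun i => realVec (y i) with hM
  have hrank : M.rank = m := by
    have : LinearIndependent ℝ M.row := hy
    simpa using this.rank_matrix
  rw [Matrix.rank_eq_finrank_span_cols] at hrank
  obtain ⟨f, hf, hli⟩ : ∃ f : Fin m → Fin m → ℝ,
      (∀ i, f i ∈ Set.range M.col) ∧ LinearIndependent ℝ f := by
    obtain ⟨f, hf, -, hli⟩ := Submodule.exists_fun_fin_finrank_span_eq ℝ (Set.range M.col)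
    exact ⟨f ∘ Fin.cast hrank.symm, fun i => hf _, hli.comp _ (Fin.cast_injective _)⟩
  choose σ hσ using hf
  refine ⟨σ, fun i j hij => hli.injective (by rw [← hσ i, ← hσ j, hij]), fun h0 => ?_⟩
  have hunit : IsUnit (Matrix.of fun i j => M i (σ j)) := by
    have hcol : (Matrix.of fun i j => M i (σ j)).col = f := funext hσ
    rw [← Matrix.linearIndependent_cols_iff_isUnit, hcol]
    exact hli
  rw [Matrix.isUnit_iff_isUnit_det, isUnit_iff_ne_zero] at hunit
  apply hunit
  have h1 : ((Matrix.of fun i j => y i (σ j)).det : ℝ) = 0 := by rw [h0, Int.cast_zero]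
  rw [Int.cast_det] at h1
  exact h1

/-- A proper subspace with an integer basis of bounded minors lies in the kernel of a nonzero
integer linear form with bounded coefficients. -/
lemma HasMinorBound.exists_form {N m : ℕ} {V : Submodule ℝ (Fin N → ℝ)} {B : ℝ}
    (h : HasMinorBound m V B) (hm : m < N) :
    ∃ a : Fin N → ℤ, a ≠ 0 ∧ (∀ k, |(a k : ℝ)| ≤ (m + 1) * B) ∧
      ∀ v ∈ V, ∑ k, (a k : ℝ) * v k = 0 := by
  obtain ⟨y, hy, rfl, hB⟩ := h
  obtain ⟨σ, hσ, hdet⟩ := exists_minor_ne_zero y hy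
  obtain ⟨p, hp⟩ : ∃ p, p ∉ Set.range σ := by
    by_contra! hc
    have := Fintype.card_le_of_surjective σ hc
    simp at this
    omega
  set τ : Fin (m + 1) → Fin N := Fin.cons p σ with hτ
  have hτinj : Function.Injective τ := Fin.cons_injective_iff.2 ⟨hp, hσ⟩
  set D : Fin (m + 1) → ℤ := fun j => (Matrix.of fun i k => y i (τ (j.succAbove k))).det with hD
  have hDB : ∀ j, |(D j : ℝ)| ≤ B := fun j => hB fun k => τ (j.succAbove k)
  have hB0 : 0 ≤ B := (abs_nonneg _).trans (hDB 0)
  refine ⟨fun k => ∑ j, if τ j = k then (-1) ^ (j : ℕ) * D j else 0, ?_, fun k => ?_,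
    fun v hv => ?_⟩
  · intro h0
    have h1 := congrFun h0 (τ 0)
    simp only [hτinj.eq_iff, Finset.sum_ite_eq', Finset.mem_univ, if_true] at h1
    apply hdet
    simpa [hD, hτ] using h1
  · push_cast
    refine (Finset.abs_sum_le_sum_abs _ _).trans ?_
    refine (Finset.sum_le_card_nsmul _ _ B fun j _ => ?_).trans (le_of_eq (by simp))
    split_ifs
    · simpa [abs_mul] using hDB j
    · simpa using hB0
  · push_cast
    refine Eq.trans ?_ (sum_minors_eq_zero y τ hv)
    simp_rw [Finset.sum_mul]
    rw [Finset.sum_comm]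
    refine Finset.sum_congr rfl fun j _ => ?_
    simp only [ite_mul, zero_mul, Finset.sum_ite_eq, Finset.mem_univ, if_true]
    ring

/-- A nonzero integer vector starts a linearly independent family of full size. -/
lemma exists_integer_basis {n : ℕ} (x : Fin (n + 1) → ℤ) (hx : x ≠ 0) :
    ∃ f : Fin (n + 1) → Fin (n + 1) → ℤ, f 0 = x ∧ LinearIndependent ℝ fun i => realVec (f i) := by
  obtain ⟨p, hp⟩ := Function.ne_iff.1 hx
  refine ⟨Fin.cons x fun i => Pi.single (p.succAbove i) 1, rfl, ?_⟩
  have hcons : (fun i => realVec ((Fin.cons x fun i => Pi.single (p.succAbove i) 1 :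
      Fin (n + 1) → Fin (n + 1) → ℤ) i)) =
      (Fin.cons (realVec x) (fun i => Pi.single (p.succAbove i) 1) :
        Fin (n + 1) → Fin (n + 1) → ℝ) := by
    funext i
    refine Fin.cases rfl (fun i => ?_) i
    funext k
    simp [realVec, Pi.single_apply]
  rw [hcons, linearIndependent_finCons]
  constructor
  · exact (Pi.linearIndependent_single_one (Fin (n + 1)) ℝ).comp _ Fin.succAbove_right_injective
  · intro hmem
    have hle : Submodule.span ℝ (Set.range fun i : Fin n =>
        (Pi.single (p.succAbove i) 1 : Fin (n + 1) → ℝ)) ≤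
        LinearMap.ker (LinearMap.proj (R := ℝ) (φ := fun _ : Fin (n + 1) => ℝ) p) := by
      rw [Submodule.span_le]
      rintro _ ⟨i, rfl⟩
      simp [(Fin.succAbove_ne p i).symm]
    have := hle hmem
    simp [realVec] at this
    exact hp this

/-- Every nonzero integer vector lies in the first step of a flag with integer bases. -/
lemma exists_initial_flag {n : ℕ} (x : Fin (n + 1) → ℤ) (hx : x ≠ 0) :
    ∃ (W : ℕ → Submodule ℝ (Fin (n + 1) → ℝ)) (β : ℕ → ℝ), Monotone W ∧ realVec x ∈ W 0 ∧
      ∀ m ≤ n, HasMinorBound (m + 1) (W m) (β m) := by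
  obtain ⟨f, hf0, hf⟩ := exists_integer_basis x hx
  set W : ℕ → Submodule ℝ (Fin (n + 1) → ℝ) := fun m =>
    Submodule.span ℝ ((fun i => realVec (f i)) '' {i | (i : ℕ) ≤ m}) with hW
  have hbound : ∀ m, ∃ B, m ≤ n → HasMinorBound (m + 1) (W m) B := by
    intro m
    by_cases hm : m ≤ n
    · have hle : m + 1 ≤ n + 1 := by omega
      obtain ⟨B, hB⟩ := exists_hasMinorBound (fun i : Fin (m + 1) => f (Fin.castLE hle i))
        (hf.comp _ (Fin.castLE_injective hle))
      refine ⟨B, fun _ => ?_⟩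
      convert hB using 1
      simp only [hW]
      congr 1
      ext v
      constructor
      · rintro ⟨i, hi, rfl⟩
        exact ⟨⟨i, Nat.lt_succ_of_le hi⟩, rfl⟩
      · rintro ⟨i, rfl⟩
        exact ⟨Fin.castLE hle i, Nat.le_of_lt_succ i.2, rfl⟩
    · exact ⟨0, fun h => absurd h hm⟩
  choose β hβ using hbound
  refine ⟨W, β, fun m m' hmm' => Submodule.span_mono (Set.image_mono fun i hi => ?_), ?_, hβ⟩
  · exact le_trans hi hmm'
  · rw [← hf0]
    exact Submodule.subset_span ⟨0, by simp, rfl⟩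

/-- Along a sequence of integer points, one can build a sequence of flags whose steps have
integer bases with controlled minors. -/
lemma exists_flag {N M : ℕ} (x : ℕ → Fin N → ℤ) (hx : ∀ i, x i ≠ 0)
    (c r : ℕ → ℝ) (hr : ∀ i, 0 ≤ r i)
    (hxr : ∀ i k, |(x (i + 1) k : ℝ) - c i * x i k| ≤ r i)
    (b : ℕ → ℕ → ℝ) (hb0 : ∀ i k, |(x (i + 1) k : ℝ)| ≤ b 0 (i + 1))
    (hmono : ∀ m ≤ M, ∀ i, b m i ≤ b m (i + 1))
    (hstep : ∀ m < M, ∀ i, (m + 2) * (r i * b m i) ≤ b (m + 1) (i + 1))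
    (hinit : ∃ W : ℕ → Submodule ℝ (Fin N → ℝ), Monotone W ∧ realVec (x 0) ∈ W 0 ∧
      ∀ m ≤ M, HasMinorBound (m + 1) (W m) (b m 0)) (i : ℕ) :
    ∃ W : ℕ → Submodule ℝ (Fin N → ℝ), Monotone W ∧ realVec (x i) ∈ W 0 ∧
      ∀ m ≤ M, HasMinorBound (m + 1) (W m) (b m i) := by
  induction i with
  | zero => exact hinit
  | succ i ih =>
    obtain ⟨W, hWmono, hxW, hWb⟩ := ih
    classical
    set v := realVec (x (i + 1)) with hv
    let W' : ℕ → Submodule ℝ (Fin N → ℝ) := fun m => match m with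
      | 0 => Submodule.span ℝ {v}
      | m + 1 => if v ∈ W m then W (m + 1) else W m ⊔ Submodule.span ℝ {v}
    have hle : ∀ m, W' m ≤ W m ⊔ Submodule.span ℝ {v} := by
      intro m
      cases m with
      | zero => exact le_sup_right
      | succ m =>
        simp only [W']
        split_ifs
        · exact le_sup_left
        · exact sup_le_sup_right (hWmono m.le_succ) _
    refine ⟨W', monotone_nat_of_le_succ fun m => ?_, Submodule.mem_span_singleton_self v,
      fun m hm => ?_⟩
    · refine (hle m).trans ?_
      simp only [W']
      split_ifs with h
      · rw [sup_le_iff, Submodule.span_singleton_le_iff_mem]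
        exact ⟨hWmono m.le_succ, hWmono m.le_succ h⟩
      · exact le_rfl
    · cases m with
      | zero =>
        have h := hasMinorBound_bot.sup_span (x (i + 1)) 0 (Submodule.zero_mem _)
          (r := b 0 (i + 1)) ?_ (by simpa using hb0 i) ?_
        · simpa [W'] using h
        · obtain ⟨k, -⟩ := Function.ne_iff.1 (hx i)
          exact (abs_nonneg _).trans (hb0 i k)
        · rw [Submodule.mem_bot]
          intro h
          apply hx (i + 1)
          funext k
          simpa [realVec] using congrFun h k
      | succ m =>
        simp only [W']
        split_ifs with h
        · exact (hWb (m + 1) hm).mono (hmono (m + 1) hm i)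
        · refine ((hWb m (by omega)).sup_span (x (i + 1)) (c i • realVec (x i))
            (Submodule.smul_mem _ _ (hWmono (Nat.zero_le m) hxW)) (hr i) (hxr i) h).mono ?_
          refine le_trans (le_of_eq ?_) (hstep m (by omega) i)
          push_cast
          ring

lemma abs_le_inorm {n : ℕ} (x : Fin (n + 1) → ℤ) (k : Fin (n + 1)) : |(x k : ℝ)| ≤ inorm x := by
  rw [← Real.sqrt_sq_eq_abs]
  exact Real.sqrt_le_sqrt
    (Finset.single_le_sum (f := fun k => (x k : ℝ) ^ 2) (fun i _ => sq_nonneg _)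
      (Finset.mem_univ k))

lemma inorm_le_sum {n : ℕ} (x : Fin (n + 1) → ℤ) : inorm x ≤ ∑ k, |(x k : ℝ)| := by
  refine Real.sqrt_le_iff.2 ⟨Finset.sum_nonneg fun k _ => abs_nonneg _, ?_⟩
  simp_rw [← sq_abs (x _ : ℝ)]
  exact Finset.sum_sq_le_sq_sum_of_nonneg fun k _ => abs_nonneg _

lemma finite_abs_le {N : ℕ} (C : ℝ) : {x : Fin N → ℤ | ∀ k, |(x k : ℝ)| ≤ C}.Finite := by
  refine (Set.finite_Icc (fun _ : Fin N => -⌊C⌋) (fun _ => ⌊C⌋)).subset fun x hx => ?_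
  have h : ∀ k, |x k| ≤ ⌊C⌋ := fun k => Int.le_floor.2 (by simpa using hx k)
  exact ⟨fun k => (abs_le.1 (h k)).1, fun k => (abs_le.1 (h k)).2⟩

lemma finite_inorm_le {n : ℕ} (X : ℝ) : {x : Fin (n + 1) → ℤ | inorm x ≤ X}.Finite :=
  (finite_abs_le X).subset fun x hx k => (abs_le_inorm x k).trans hx

lemma abs_le_Lxi {n : ℕ} (ξ : Fin (n + 1) → ℝ) (x : Fin (n + 1) → ℤ) (k : Fin (n + 1)) :
    |ξ 0 * (x k : ℝ) - ξ k * (x 0 : ℝ)| ≤ Lxi ξ x :=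
  Finset.le_sup' (fun k => |ξ 0 * (x k : ℝ) - ξ k * (x 0 : ℝ)|) (Finset.mem_univ k)

lemma Lxi_nonneg {n : ℕ} (ξ : Fin (n + 1) → ℝ) (x : Fin (n + 1) → ℤ) : 0 ≤ Lxi ξ x :=
  (abs_nonneg _).trans (abs_le_Lxi ξ x 0)

lemma exists_Lxi_le_of_calL_le {n : ℕ} {ξ : Fin (n + 1) → ℝ} {S : Set (Fin (n + 1) → ℤ)}
    {X B : ℝ} (hB : 0 ≤ B) (h : calL ξ S X ≤ ENNReal.ofReal B) :
    ∃ x ∈ S, x ≠ 0 ∧ inorm x ≤ X ∧ Lxi ξ x ≤ B := by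
  set T : Set ENNReal :=
    {l | ∃ x ∈ S, x ≠ 0 ∧ inorm x ≤ X ∧ l = ENNReal.ofReal (Lxi ξ x)} with hT
  have hfin : T.Finite := by
    refine ((finite_inorm_le X).image fun x => ENNReal.ofReal (Lxi ξ x)).subset ?_
    rintro l ⟨x, -, -, hx, rfl⟩
    exact ⟨x, hx, rfl⟩
  have hne : T.Nonempty := by
    by_contra hempty
    rw [Set.not_nonempty_iff_eq_empty] at hempty
    have : calL ξ S X = ⊤ := by
      change sInf T = ⊤
      rw [hempty, sInf_empty]
    rw [this] at h
    exact absurd h (by simp)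
  obtain ⟨x, hxS, hx0, hxX, hx⟩ := hne.csInf_mem hfin
  refine ⟨x, hxS, hx0, hxX, ?_⟩
  rwa [calL, hx, ENNReal.ofReal_le_ofReal_iff hB] at h

lemma le_Lxi_of_le_calL {n : ℕ} {ξ : Fin (n + 1) → ℝ} {S : Set (Fin (n + 1) → ℤ)}
    {X B : ℝ} (h : ENNReal.ofReal B ≤ calL ξ S X) {x : Fin (n + 1) → ℤ} (hxS : x ∈ S)
    (hx0 : x ≠ 0) (hxX : inorm x ≤ X) : B ≤ Lxi ξ x :=
  (ENNReal.ofReal_le_ofReal_iff (Lxi_nonneg ξ x)).1 (h.trans (sInf_le ⟨x, hxS, hx0, hxX, rfl⟩))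

/-- Points close to the line spanned by `ξ` have a comparatively large first coordinate. -/
lemma exists_inorm_le_mul {n : ℕ} (ξ : Fin (n + 1) → ℝ) (hξ : ξ 0 ≠ 0) :
    ∃ K > 0, ∀ x : Fin (n + 1) → ℤ, x ≠ 0 → Lxi ξ x < |ξ 0| →
      1 ≤ |(x 0 : ℝ)| ∧ inorm x ≤ K * |(x 0 : ℝ)| := by
  have hξ' : 0 < |ξ 0| := abs_pos.2 hξ
  refine ⟨∑ k, (|ξ k| + |ξ 0|) / |ξ 0|,
    Finset.sum_pos (fun k _ => by positivity) Finset.univ_nonempty, fun x hx hL => ?_⟩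
  have hx0 : x 0 ≠ 0 := by
    intro h0
    apply hx
    funext k
    have h1 := (abs_le_Lxi ξ x k).trans_lt hL
    rw [h0, Int.cast_zero, mul_zero, sub_zero, abs_mul] at h1
    have h2 : |(x k : ℝ)| < 1 := by nlinarith
    exact Int.abs_lt_one_iff.1 (by exact_mod_cast h2)
  have hx1 : 1 ≤ |(x 0 : ℝ)| := by exact_mod_cast Int.one_le_abs hx0
  refine ⟨hx1, (inorm_le_sum x).trans ?_⟩
  rw [Finset.sum_mul]
  refine Finset.sum_le_sum fun k _ => ?_
  rw [div_mul_eq_mul_div, le_div_iff₀ hξ']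
  have h1 := (abs_le_Lxi ξ x k).trans_lt hL
  have h2 : |ξ 0 * (x k : ℝ)| ≤ |ξ 0 * (x k : ℝ) - ξ k * (x 0 : ℝ)| + |ξ k * (x 0 : ℝ)| := by
    simpa using abs_add_le (ξ 0 * (x k : ℝ) - ξ k * (x 0 : ℝ)) (ξ k * (x 0 : ℝ))
  rw [abs_mul, abs_mul (ξ k)] at h2
  nlinarith

/-- If `S` contains points approximating `ξ` at every scale `X ≥ A` with the precision `φ X`, then
each scale is followed by a minimal point of `S`. -/
lemma exists_next_minimal_point {n : ℕ} {ξ : Fin (n + 1) → ℝ} {S : Set (Fin (n + 1) → ℤ)}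
    {A : ℝ} {φ ψ : ℝ → ℝ} (hφ : ContinuousOn φ (Set.Ici A)) (hψpos : ∀ X, A ≤ X → 0 < ψ X)
    (hφlim : Tendsto φ atTop (nhds 0))
    (hupper : ∀ X, A ≤ X → ∃ x ∈ S, x ≠ 0 ∧ inorm x ≤ X ∧ Lxi ξ x ≤ φ X)
    (hlower : ∀ X, A ≤ X → ∀ x ∈ S, x ≠ 0 → inorm x ≤ X → ψ X ≤ Lxi ξ x)
    {Y : ℝ} (hY : A ≤ Y) :
    ∃ z ∈ S, z ≠ 0 ∧ Y < inorm z ∧ (∀ w ∈ S, w ≠ 0 → inorm w ≤ inorm z → Lxi ξ z ≤ Lxi ξ w) ∧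
      ∃ w ∈ S, w ≠ 0 ∧ inorm w ≤ Y ∧ Lxi ξ w ≤ φ (inorm z) := by
  obtain ⟨z₀, ⟨hz₀S, hz₀0, hz₀Y⟩, hz₀⟩ := Set.exists_min_image
    {w | w ∈ S ∧ w ≠ 0 ∧ inorm w ≤ Y} (Lxi ξ) ((finite_inorm_le Y).subset fun w hw => hw.2.2)
    (by obtain ⟨w, h1, h2, h3, -⟩ := hupper Y hY; exact ⟨w, h1, h2, h3⟩)
  have hz₀pos : 0 < Lxi ξ z₀ := (hψpos Y hY).trans_le (hlower Y hY z₀ hz₀S hz₀0 hz₀Y)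
  obtain ⟨X, hXlt, hAX⟩ := ((hφlim.eventually_lt_const hz₀pos).and (eventually_ge_atTop A)).exists
  obtain ⟨w₀, hw₀S, hw₀0, -, hw₀⟩ := hupper X hAX
  obtain ⟨w₁, ⟨⟨hw₁S, hw₁0, hw₁⟩, -⟩, hw₁min⟩ := Set.exists_min_image
    {w | (w ∈ S ∧ w ≠ 0 ∧ Lxi ξ w < Lxi ξ z₀) ∧ inorm w ≤ inorm w₀} inorm
    ((finite_inorm_le (inorm w₀)).subset fun w hw => hw.2)
    ⟨w₀, ⟨hw₀S, hw₀0, hw₀.trans_lt hXlt⟩, le_rfl⟩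
  have hmin : ∀ w ∈ S, w ≠ 0 → Lxi ξ w < Lxi ξ z₀ → inorm w₁ ≤ inorm w := by
    intro w hwS hw0 hw
    rcases le_total (inorm w) (inorm w₀) with h | h
    · exact hw₁min w ⟨⟨hwS, hw0, hw⟩, h⟩
    · exact (hw₁min w₀ ⟨⟨hw₀S, hw₀0, hw₀.trans_lt hXlt⟩, le_rfl⟩).trans h
  obtain ⟨z, ⟨hzS, hz0, hzn⟩, hz⟩ := Set.exists_min_image
    {w | w ∈ S ∧ w ≠ 0 ∧ inorm w ≤ inorm w₁} (Lxi ξ)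
    ((finite_inorm_le (inorm w₁)).subset fun w hw => hw.2.2) ⟨w₁, hw₁S, hw₁0, le_rfl⟩
  have hzlt : Lxi ξ z < Lxi ξ z₀ := (hz w₁ ⟨hw₁S, hw₁0, le_rfl⟩).trans_lt hw₁
  have hYz : Y < inorm z := by
    by_contra! h
    exact absurd (hz₀ z ⟨hzS, hz0, h⟩) (not_le.2 hzlt)
  refine ⟨z, hzS, hz0, hYz, fun w hwS hw0 hw => hz w ⟨hwS, hw0, hw.trans hzn⟩,
    z₀, hz₀S, hz₀0, hz₀Y, ?_⟩
  have hcont : Tendsto φ (nhdsWithin (inorm z) (Set.Ico A (inorm z))) (nhds (φ (inorm z))) :=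
    (hφ (inorm z) (hY.trans hYz.le)).mono Set.Ico_subset_Ici_self
  have : (nhdsWithin (inorm z) (Set.Ico A (inorm z))).NeBot := by
    rw [← mem_closure_iff_nhdsWithin_neBot, closure_Ico (hY.trans_lt hYz).ne]
    exact ⟨hY.trans hYz.le, le_rfl⟩
  refine ge_of_tendsto hcont ?_
  filter_upwards [self_mem_nhdsWithin] with T hT
  obtain ⟨w, hwS, hw0, hwT, hw⟩ := hupper T hT.1
  refine le_trans ?_ hw
  by_contra! hlt
  exact absurd ((hzn.trans (hmin w hwS hw0 hlt)).trans hwT) (not_le.2 hT.2)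

/-- The sequence of minimal points of `S`. -/
lemma exists_minimal_seq {n : ℕ} {ξ : Fin (n + 1) → ℝ} {S : Set (Fin (n + 1) → ℤ)}
    {A : ℝ} {φ ψ : ℝ → ℝ} (hφ : ContinuousOn φ (Set.Ici A)) (hψpos : ∀ X, A ≤ X → 0 < ψ X)
    (hφlim : Tendsto φ atTop (nhds 0))
    (hupper : ∀ X, A ≤ X → ∃ x ∈ S, x ≠ 0 ∧ inorm x ≤ X ∧ Lxi ξ x ≤ φ X)
    (hlower : ∀ X, A ≤ X → ∀ x ∈ S, x ≠ 0 → inorm x ≤ X → ψ X ≤ Lxi ξ x) :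
    ∃ x : ℕ → Fin (n + 1) → ℤ, (∀ i, x i ≠ 0) ∧ (∀ i, A ≤ inorm (x i)) ∧
      StrictMono (fun i => inorm (x i)) ∧ Antitone (fun i => Lxi ξ (x i)) ∧
      (∀ i, ψ (inorm (x i)) ≤ Lxi ξ (x i)) ∧ ∀ i, Lxi ξ (x i) ≤ φ (inorm (x (i + 1))) := by
  choose! z hzS hz0 hzY hzmin w hwS hw0 hwY hw using
    fun Y (hY : A ≤ Y) => exists_next_minimal_point hφ hψpos hφlim hupper hlower hY
  set Y : ℕ → ℝ := fun i => (fun T => inorm (z T))^[i] A with hYdef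
  have hsucc : ∀ i, Y (i + 1) = inorm (z (Y i)) := fun i => Function.iterate_succ_apply' _ _ _
  have hA : ∀ i, A ≤ Y i := by
    intro i
    induction i with
    | zero => exact le_rfl
    | succ i ih =>
      rw [hsucc]
      exact ih.trans (hzY _ ih).le
  have hmono : StrictMono fun i => inorm (z (Y i)) := strictMono_nat_of_lt_succ fun i => by
    rw [← hsucc i]
    exact hzY _ (hA (i + 1))
  refine ⟨fun i => z (Y i), fun i => hz0 _ (hA i), fun i => hsucc i ▸ hA (i + 1), hmono,
    antitone_nat_of_succ_le fun i => hzmin _ (hA _) _ (hzS _ (hA _)) (hz0 _ (hA _))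
      (hmono i.lt_succ_self).le,
    fun i => hlower _ (hsucc i ▸ hA (i + 1)) _ (hzS _ (hA _)) (hz0 _ (hA _)) le_rfl, fun i => ?_⟩
  have hi := hA (i + 1)
  refine le_trans (hzmin _ (hA i) _ (hwS _ hi) (hw0 _ hi) ?_) (hw _ hi)
  rw [← hsucc i]
  exact hwY _ hi

lemma tendsto_inorm_atTop {n : ℕ} {x : ℕ → Fin (n + 1) → ℤ}
    (hx : StrictMono fun i => inorm (x i)) : Tendsto (fun i => inorm (x i)) atTop atTop := by
  refine tendsto_atTop_atTop_of_monotone hx.monotone fun B => ?_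
  by_contra! h
  refine Set.infinite_range_of_injective (f := x) (fun i j hij => hx.injective (by simp [hij])) ?_
  exact (finite_inorm_le B).subset (by rintro _ ⟨i, rfl⟩; exact (h i).le)

/-- Approximations to a point with linearly independent coordinates cannot all satisfy nonzero
integer linear equations with bounded coefficients. -/
lemma false_of_bounded_forms {n : ℕ} {ξ : Fin (n + 1) → ℝ} (hξ : LinearIndependent ℚ ξ)
    {x : ℕ → Fin (n + 1) → ℤ} (hx : ∀ i, 1 ≤ |(x i 0 : ℝ)|)
    (hlim : Tendsto (fun i => Lxi ξ (x i)) atTop (nhds 0)) {C : ℝ}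
    (hform : ∀ i, ∃ a : Fin (n + 1) → ℤ, a ≠ 0 ∧ (∀ k, |(a k : ℝ)| ≤ C) ∧
      ∑ k, (a k : ℝ) * x i k = 0) : False := by
  choose a ha0 haC hax using hform
  have : Finite {a : Fin (n + 1) → ℤ | ∀ k, |(a k : ℝ)| ≤ C} := (finite_abs_le C).to_subtype
  obtain ⟨⟨d, hd⟩, hinf⟩ := Finite.exists_infinite_fiber
    fun i => (⟨a i, haC i⟩ : {a : Fin (n + 1) → ℤ | ∀ k, |(a k : ℝ)| ≤ C})
  have hfreq : ∃ᶠ i in atTop, a i = d := by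
    rw [Nat.frequently_atTop_iff_infinite]
    convert Set.infinite_coe_iff.1 hinf using 1
    ext i
    simp
  have hbound : ∀ i, a i = d → |∑ k, (d k : ℝ) * ξ k| ≤ (∑ k, |(d k : ℝ)|) * Lxi ξ (x i) := by
    intro i hi
    have h0 := hax i
    rw [hi] at h0
    have h1 : (x i 0 : ℝ) * ∑ k, (d k : ℝ) * ξ k =
        -∑ k, (d k : ℝ) * (ξ 0 * x i k - ξ k * x i 0) := by
      have : ∑ k, (d k : ℝ) * (ξ 0 * x i k - ξ k * x i 0) =
          ξ 0 * ∑ k, (d k : ℝ) * x i k - (x i 0 : ℝ) * ∑ k, (d k : ℝ) * ξ k := by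
        rw [Finset.mul_sum, Finset.mul_sum, ← Finset.sum_sub_distrib]
        exact Finset.sum_congr rfl fun k _ => by ring
      rw [this, h0]
      ring
    calc |∑ k, (d k : ℝ) * ξ k| ≤ |(x i 0 : ℝ)| * |∑ k, (d k : ℝ) * ξ k| :=
          le_mul_of_one_le_left (abs_nonneg _) (hx i)
      _ = |∑ k, (d k : ℝ) * (ξ 0 * x i k - ξ k * x i 0)| := by rw [← abs_mul, h1, abs_neg]
      _ ≤ ∑ k, |(d k : ℝ) * (ξ 0 * x i k - ξ k * x i 0)| := Finset.abs_sum_le_sum_abs _ _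
      _ ≤ (∑ k, |(d k : ℝ)|) * Lxi ξ (x i) := by
          rw [Finset.sum_mul]
          refine Finset.sum_le_sum fun k _ => ?_
          rw [abs_mul]
          exact mul_le_mul_of_nonneg_left (abs_le_Lxi ξ (x i) k) (abs_nonneg _)
  have hzero : ∑ k, (d k : ℝ) * ξ k = 0 := by
    have h1 := hlim.const_mul (∑ k, |(d k : ℝ)|)
    rw [mul_zero] at h1
    exact abs_nonpos_iff.1 (ge_of_tendsto_of_frequently h1 (hfreq.mono hbound))
  obtain ⟨i, hi⟩ := hfreq.exists
  apply ha0 i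
  funext k
  have h2 := Fintype.linearIndependent_iff.1 hξ (fun k => (d k : ℚ))
    (by simpa [Rat.smul_def] using hzero) k
  rw [hi]
  exact_mod_cast h2

/-- If `Φ_0, …, Φ_{k-1}` are increasing, then `Φ_k` cannot be decreasing. -/
lemma not_antitoneOn_PhiFun {n k : ℕ} {ξ : Fin (n + 1) → ℝ} (hξ : LinearIndependent ℚ ξ)
    {I : Set ℝ} {A : ℝ} (hA : 0 < A) {φ θ : ℝ → ℝ}
    (hφpos : ∀ X ∈ I, 0 < φ X) (hφanti : AntitoneOn φ I) (hθmono : MonotoneOn θ I)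
    (hφlim : Tendsto φ atTop (nhds 0))
    (hiter : ∀ j ≤ n - 1, ∀ X, A ≤ X → θ^[j] X ∈ I)
    {x : ℕ → Fin (n + 1) → ℤ} (hx0 : ∀ i, x i ≠ 0) (hxA : ∀ i, A ≤ inorm (x i))
    (hxmono : StrictMono fun i => inorm (x i)) (hL : Antitone fun i => Lxi ξ (x i))
    (hLφ : ∀ i, Lxi ξ (x i) ≤ φ (inorm (x (i + 1))))
    (hθx : ∀ i, θ (inorm (x (i + 1))) ≤ inorm (x i)) (hk : k + 2 ≤ n)
    (hmono : ∀ j < k, MonotoneOn (PhiFun φ θ j) (Set.Ici A)) :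
    ¬ AntitoneOn (PhiFun φ θ k) (Set.Ici A) := by
  intro hanti
  have hξ0 : ξ 0 ≠ 0 := hξ.ne_zero 0
  have hLlim : Tendsto (fun i => Lxi ξ (x i)) atTop (nhds 0) :=
    squeeze_zero (fun i => Lxi_nonneg ξ _) hLφ
      (hφlim.comp ((tendsto_inorm_atTop hxmono).comp (tendsto_add_atTop_nat 1)))
  obtain ⟨K, hK, hKx⟩ := exists_inorm_le_mul ξ hξ0
  obtain ⟨i₀, hi₀⟩ := eventually_atTop.1 (hLlim.eventually_lt_const (abs_pos.2 hξ0))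
  -- Discard finitely many points, so that all first coordinates are large.
  wlog hi₀' : i₀ = 0 generalizing x i₀
  · refine this (x := fun i => x (i + i₀)) (fun i => hx0 _) (fun i => hxA _)
      (fun i j hij => hxmono (by omega)) (fun i j hij => hL (by omega))
      (fun i => ?_) (fun i => ?_) (hLlim.comp (tendsto_add_atTop_nat i₀)) 0
      (fun i _ => hi₀ _ (by omega)) rfl
    · simpa [add_right_comm] using hLφ (i + i₀)
    · simpa [add_right_comm] using hθx (i + i₀)
  subst hi₀'
  have hlarge : ∀ i, 1 ≤ |(x i 0 : ℝ)| ∧ inorm (x i) ≤ K * |(x i 0 : ℝ)| :=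
    fun i => hKx _ (hx0 i) (hi₀ i (Nat.zero_le i))
  set X : ℕ → ℝ := fun i => inorm (x i) with hX
  have hXpos : ∀ i, 0 < X i := fun i => hA.trans_le (hxA i)
  set Ψ : ℕ → ℝ → ℝ := fun m Y => Y * ∏ j ∈ Finset.range m, φ (θ^[j] Y) with hΨ
  have hΨpos : ∀ m ≤ k + 1, ∀ Y, A ≤ Y → 0 < Ψ m Y := fun m hm Y hY =>
    mul_pos (hA.trans_le hY) (Finset.prod_pos fun j hj => hφpos _ (hiter j
      (by have := Finset.mem_range.1 hj; omega) Y hY))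
  have hΨmono : ∀ m ≤ k, ∀ i, Ψ m (X i) ≤ Ψ m (X (i + 1)) := by
    intro m hm i
    cases m with
    | zero => simpa [hΨ] using (hxmono i.lt_succ_self).le
    | succ m => exact hmono m (by omega) (hxA i) (hxA (i + 1)) (hxmono i.lt_succ_self).le
  have hΨanti : ∀ i, Ψ (k + 1) (X i) ≤ Ψ (k + 1) (X 0) := fun i =>
    hanti (hxA 0) (hxA i) (hxmono.monotone (Nat.zero_le i))
  have hiter_le : ∀ i, ∀ j < k, θ^[j + 1] (X (i + 1)) ≤ θ^[j] (X i) := by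
    intro i j hj
    induction j with
    | zero => exact hθx i
    | succ j ih =>
      rw [Function.iterate_succ_apply' θ (j + 1) (X (i + 1)), Function.iterate_succ_apply' θ j (X i)]
      exact hθmono (hiter _ (by omega) _ (hxA _)) (hiter _ (by omega) _ (hxA _)) (ih (by omega))
  have hΨstep : ∀ m ≤ k, ∀ i,
      X (i + 1) * φ (X (i + 1)) / X i * Ψ m (X i) ≤ Ψ (m + 1) (X (i + 1)) := by
    intro m hm i
    have hprod : ∏ j ∈ Finset.range m, φ (θ^[j] (X i)) ≤
        ∏ j ∈ Finset.range m, φ (θ^[j + 1] (X (i + 1))) := by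
      refine Finset.prod_le_prod (fun j hj => ?_) fun j hj => ?_ <;>
        have hj' := Finset.mem_range.1 hj
      · exact (hφpos _ (hiter j (by omega) _ (hxA i))).le
      · exact hφanti (hiter _ (by omega) _ (hxA _)) (hiter _ (by omega) _ (hxA _))
          (hiter_le i j (by omega))
    have hφ0 : 0 < φ (X (i + 1)) := hφpos _ (hiter 0 (by omega) _ (hxA _))
    calc X (i + 1) * φ (X (i + 1)) / X i * Ψ m (X i)
        = X (i + 1) * φ (X (i + 1)) * ∏ j ∈ Finset.range m, φ (θ^[j] (X i)) := by
          simp only [hΨ]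
          field_simp [(hXpos i).ne']
      _ ≤ X (i + 1) * φ (X (i + 1)) * ∏ j ∈ Finset.range m, φ (θ^[j + 1] (X (i + 1))) :=
          mul_le_mul_of_nonneg_left hprod (mul_pos (hXpos _) hφ0).le
      _ = Ψ (m + 1) (X (i + 1)) := by
          simp only [hΨ]
          rw [Finset.prod_range_succ', Function.iterate_zero_apply]
          ring
  obtain ⟨W, β, hWmono, hxW, hβ⟩ := exists_initial_flag (x 0) (hx0 0)
  set R : ℝ := 2 * K / |ξ 0| with hR
  have hRpos : 0 < R := by have := abs_pos.2 hξ0; positivity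
  set Q : ℝ := max 1 ((n + 2) * R) with hQ
  have hQ1 : 1 ≤ Q := le_max_left _ _
  set C₀ : ℝ := 1 + ∑ m ∈ Finset.range (k + 2), |β m| / Ψ m (X 0) with hC₀
  have hC₀1 : 1 ≤ C₀ := le_add_of_nonneg_right (Finset.sum_nonneg fun m hm =>
    div_nonneg (abs_nonneg _) (hΨpos m (by have := Finset.mem_range.1 hm; omega) _ (hxA 0)).le)
  have hβC : ∀ m ≤ k + 1, β m ≤ C₀ * Ψ m (X 0) := by
    intro m hm
    have h1 := Finset.single_le_sum (f := fun m => |β m| / Ψ m (X 0))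
      (fun m hm => div_nonneg (abs_nonneg _)
        (hΨpos m (by have := Finset.mem_range.1 hm; omega) _ (hxA 0)).le)
      (Finset.mem_range.2 (show m < k + 2 by omega))
    rw [← div_le_iff₀ (hΨpos m hm _ (hxA 0))]
    have h2 : β m / Ψ m (X 0) ≤ |β m| / Ψ m (X 0) :=
      div_le_div_of_nonneg_right (le_abs_self _) (hΨpos m hm _ (hxA 0)).le
    linarith
  set b : ℕ → ℕ → ℝ := fun m i => C₀ * Q ^ m * Ψ m (X (if m ≤ k then i else 0)) with hb
  set r : ℕ → ℝ := fun i => R * (X (i + 1) * φ (X (i + 1)) / X i) with hr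
  have hφX : ∀ i, 0 < φ (X i) := fun i => hφpos _ (hiter 0 (by omega) _ (hxA _))
  have hrpos : ∀ i, 0 ≤ r i := fun i =>
    (mul_pos hRpos (div_pos (mul_pos (hXpos _) (hφX _)) (hXpos i))).le
  have hdist : ∀ i j, |(x (i + 1) j : ℝ) - (x (i + 1) 0 / x i 0 : ℝ) * x i j| ≤ r i := by
    intro i j
    have hx1 : 0 < |(x i 0 : ℝ)| := zero_lt_one.trans_le (hlarge i).1
    have hξ0' := abs_pos.2 hξ0
    have hxne : (x i 0 : ℝ) ≠ 0 := abs_pos.1 hx1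
    have h1 : ξ 0 * x i 0 * ((x (i + 1) j : ℝ) - (x (i + 1) 0 / x i 0 : ℝ) * x i j) =
        x i 0 * (ξ 0 * x (i + 1) j - ξ j * x (i + 1) 0) -
          x (i + 1) 0 * (ξ 0 * x i j - ξ j * x i 0) := by
      field_simp
      ring
    have h2 : |ξ 0| * |(x i 0 : ℝ)| *
        |(x (i + 1) j : ℝ) - (x (i + 1) 0 / x i 0 : ℝ) * x i j| ≤
        2 * (X (i + 1) * φ (X (i + 1))) := by
      rw [← abs_mul, ← abs_mul, h1]
      refine (abs_sub _ _).trans ?_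
      rw [abs_mul, abs_mul, two_mul]
      refine add_le_add ?_ ?_
      · exact mul_le_mul ((abs_le_inorm _ _).trans (hxmono i.lt_succ_self).le)
          ((abs_le_Lxi _ _ _).trans ((hL i.le_succ).trans (hLφ i))) (abs_nonneg _) (hXpos _).le
      · exact mul_le_mul (abs_le_inorm _ _) ((abs_le_Lxi _ _ _).trans (hLφ i)) (abs_nonneg _)
          (hXpos _).le
    have h3 : r i = 2 * (X (i + 1) * φ (X (i + 1))) * (K / (|ξ 0| * X i)) := by
      simp only [hr, hR]
      field_simp
    rw [h3]
    have h4 : 1 ≤ |ξ 0| * |(x i 0 : ℝ)| * (K / (|ξ 0| * X i)) := by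
      rw [← mul_div_assoc, le_div_iff₀ (mul_pos hξ0' (hXpos i)), one_mul]
      have := mul_le_mul_of_nonneg_left (hlarge i).2 hξ0'.le
      linarith
    have h5 : 0 ≤ K / (|ξ 0| * X i) := (div_pos hK (mul_pos hξ0' (hXpos i))).le
    have h6 := mul_le_mul_of_nonneg_right h2 h5
    refine le_trans ?_ h6
    rw [mul_right_comm]
    exact le_mul_of_one_le_left (abs_nonneg _) h4
  have hCQ : ∀ m, 1 ≤ C₀ * Q ^ m := fun m =>
    one_le_mul_of_one_le_of_one_le hC₀1 (one_le_pow₀ hQ1)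
  have hflag := exists_flag (M := k + 1) x hx0 (fun i => (x (i + 1) 0 / x i 0 : ℝ)) r hrpos hdist b
    (fun i j => ?_) (fun m hm i => ?_) (fun m hm i => ?_) ⟨W, hWmono, hxW, fun m hm => ?_⟩
  · refine false_of_bounded_forms hξ (fun i => (hlarge i).1) hLlim
      (C := ((k + 1 + 1 : ℕ) + 1) * b (k + 1) 0) fun i => ?_
    obtain ⟨V, hVmono, hxV, hV⟩ := hflag i
    obtain ⟨a, ha0, haC, ha⟩ := (hV (k + 1) le_rfl).exists_form (by omega)
    exact ⟨a, ha0, fun j => by simpa [hb] using haC j, ha _ (hVmono (Nat.zero_le _) hxV)⟩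
  · have : b 0 (i + 1) = C₀ * X (i + 1) := by simp [hb, hΨ]
    rw [this]
    exact (abs_le_inorm _ _).trans (le_mul_of_one_le_left (hXpos _).le hC₀1)
  · simp only [hb]
    split_ifs with h
    · exact mul_le_mul_of_nonneg_left (hΨmono m h i) (zero_le_one.trans (hCQ m))
    · exact le_rfl
  · have hmk : m ≤ k := by omega
    have hmn : (m : ℝ) ≤ n := by exact_mod_cast (by omega : m ≤ n)
    have h1 : b m i = C₀ * Q ^ m * Ψ m (X i) := by simp [hb, hmk]
    have h2 : C₀ * Q ^ (m + 1) * Ψ (m + 1) (X (i + 1)) ≤ b (m + 1) (i + 1) := by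
      simp only [hb]
      refine mul_le_mul_of_nonneg_left ?_ (zero_le_one.trans (hCQ _))
      split_ifs with h
      · exact le_rfl
      · obtain rfl : m = k := by omega
        exact hΨanti _
    refine le_trans ?_ h2
    have hQR : (m + 2) * R ≤ Q :=
      (mul_le_mul_of_nonneg_right (by linarith) hRpos.le).trans (le_max_right _ _)
    have h3 := hΨstep m hmk i
    have h4 : 0 < Ψ (m + 1) (X (i + 1)) := hΨpos _ (by omega) _ (hxA _)
    calc (m + 2) * (r i * b m i)
        = C₀ * Q ^ m * (((m + 2) * R) *
            (X (i + 1) * φ (X (i + 1)) / X i * Ψ m (X i))) := by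
          rw [h1]
          simp only [hr]
          ring
      _ ≤ C₀ * Q ^ m * (Q * Ψ (m + 1) (X (i + 1))) := by
          refine mul_le_mul_of_nonneg_left ?_ (zero_le_one.trans (hCQ m))
          exact (mul_le_mul_of_nonneg_left h3 (by positivity)).trans
            (mul_le_mul_of_nonneg_right hQR h4.le)
      _ = C₀ * Q ^ (m + 1) * Ψ (m + 1) (X (i + 1)) := by ring
  · refine (hβ m (by omega)).mono ((hβC m hm).trans ?_)
    simp only [hb, ite_self]
    refine mul_le_mul_of_nonneg_right ?_ (hΨpos m hm _ (hxA 0)).le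
    exact le_mul_of_one_le_right (zero_le_one.trans hC₀1) (one_le_pow₀ hQ1)

/-- Lemma 4.2: under the hypotheses (i)–(v) of the functional transference theorem, the
functions `Φ_0, Φ_1, …, Φ_{n−2}` are all monotonically increasing on `[A, ∞)`. -/
theorem Phi_monotone (n : ℕ) (hn : 1 ≤ n) (ξ : Fin (n + 1) → ℝ)
    (hξ : LinearIndependent ℚ ξ) (S : Set (Fin (n + 1) → ℤ)) (I : Set ℝ)
    (hIsub : I ⊆ Set.Ioi 0) (hIconn : I.OrdConnected) (hIunb : ¬ BddAbove I)
    (A : ℝ) (hA : A ∈ I) (φ ψ θ : ℝ → ℝ)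
    (hφcont : ContinuousOn φ I) (hψcont : ContinuousOn ψ I) (hθcont : ContinuousOn θ I)
    (hφpos : ∀ X ∈ I, 0 < φ X) (hψpos : ∀ X ∈ I, 0 < ψ X) (hθpos : ∀ X ∈ I, 0 < θ X)
    (hsandwich : ∀ X : ℝ, A ≤ X →
      ENNReal.ofReal (ψ X) ≤ calL ξ S X ∧ calL ξ S X ≤ ENNReal.ofReal (φ X))
    (hφanti : StrictAntiOn φ I) (hψanti : StrictAntiOn ψ I) (hθmono : MonotoneOn θ I)
    (hφlim : Filter.Tendsto φ Filter.atTop (nhds 0))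
    (hψlim : Filter.Tendsto ψ Filter.atTop (nhds 0))
    (hθlim : Filter.Tendsto θ Filter.atTop Filter.atTop)
    (hiter : ∀ k : ℕ, 1 ≤ k → k ≤ n - 1 → ∀ X : ℝ, A ≤ X → θ^[k] X ∈ I)
    (hfuneq : ∀ X : ℝ, A ≤ X → φ X = ψ (θ X))
    (hPhi0 : MonotoneOn (PhiFun φ θ 0) (Set.Ici A))
    (hPhiMono : ∀ k : ℕ, 1 ≤ k → k ≤ n - 1 →
      MonotoneOn (PhiFun φ θ k) (Set.Ici A) ∨ AntitoneOn (PhiFun φ θ k) (Set.Ici A)) :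
    ∀ k : ℕ, k + 2 ≤ n → MonotoneOn (PhiFun φ θ k) (Set.Ici A) := by
  have hA0 : 0 < A := hIsub hA
  have hIci : Set.Ici A ⊆ I := fun X hX => by
    obtain ⟨Y, hY, hXY⟩ := not_bddAbove_iff.1 hIunb X
    exact hIconn.out hA hY ⟨hX, hXY.le⟩
  intro k
  induction k using Nat.strong_induction_on with
  | _ k ih =>
    intro hk
    rcases Nat.eq_zero_or_pos k with rfl | hkpos
    · exact hPhi0
    refine (hPhiMono k hkpos (by omega)).resolve_right ?_
    have hiter' : ∀ j ≤ n - 1, ∀ X, A ≤ X → θ^[j] X ∈ I := by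
      intro j hj X hX
      rcases Nat.eq_zero_or_pos j with rfl | hjpos
      · exact hIci hX
      · exact hiter j hjpos hj X hX
    obtain ⟨x, hx0, hxA, hxmono, hL, hψL, hLφ⟩ := exists_minimal_seq (S := S) (ψ := ψ)
      (hφcont.mono hIci) (fun X hX => hψpos X (hIci hX)) hφlim
      (fun X hX => exists_Lxi_le_of_calL_le (hφpos X (hIci hX)).le (hsandwich X hX).2)
      (fun X hX x hxS hx0 hxX => le_Lxi_of_le_calL (hsandwich X hX).1 hxS hx0 hxX)
    refine not_antitoneOn_PhiFun hξ hA0 hφpos hφanti.antitoneOn hθmono hφlim hiter' hx0 hxA hxmono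
      hL hLφ (fun i => ?_) hk fun j hj => ih j hj (by omega)
    have h1 := (hψL i).trans (hLφ i)
    rw [hfuneq _ (hxA (i + 1))] at h1
    exact (hψanti.le_iff_ge (hIci (hxA i)) (hiter' 1 (by omega) _ (hxA (i + 1)))).1 h1
end

section
/- Let n ≥ 2 be an integer, let ξ ∈ ℝ^{n+1} have ℚ-linearly independent coordinates, and assume the setup of the functional transference theorem: S ⊆ ℤ^{n+1}, I an unbounded subinterval of (0,∞), A ∈ I, and continuous functions φ, ψ, θ : I → (0,∞) satisfying conditions (i)–(v). Let (x_i)_{i≥0} be a sequence of minimal points for ξ with respect to S, write X_i = ‖x_i‖, and let k_0 ≥ 0 be an index with X_{k_0} ≥ A. Suppose that for some integer m with 2 ≤ m ≤ n the functions Φ_0,…,Φ_{m−2} are monotonically increasing, and let j_0,…,j_{m−1} be integers with k_0 ≤ j_0 < j_1 < ⋯ < j_{m−1}. Then Φ_0(X_{j_0+1}) Φ_0(X_{j_1+1}) ⋯ Φ_0(X_{j_{m−1}+1}) ≤ X_{j_1} ⋯ X_{j_{m−1}} · Φ_{m−1}(X_{j_{m−1}+1}). -/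
open Filter

/-- `x` is a sequence of minimal points for `ξ` with respect to `S`. -/
def IsMinimalSeq {n : ℕ} (ξ : Fin (n + 1) → ℝ) (S : Set (Fin (n + 1) → ℤ))
    (x : ℕ → Fin (n + 1) → ℤ) : Prop :=
  (∀ i, x i ∈ S ∧ x i ≠ 0) ∧
  (StrictMono fun i => inorm (x i)) ∧
  (StrictAnti fun i => Lxi ξ (x i)) ∧
  ∀ i, ∀ z ∈ S, z ≠ 0 → inorm z < inorm (x (i + 1)) → Lxi ξ (x i) ≤ Lxi ξ z


lemma Set.OrdConnected.Ici_subset_of_not_bddAbove {I : Set ℝ} (hI : I.OrdConnected)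
    (hub : ¬ BddAbove I) {A : ℝ} (hA : A ∈ I) : Set.Ici A ⊆ I := by
  intro X hX
  obtain ⟨Y, hY, hXY⟩ := not_bddAbove_iff.1 hub X
  exact hI.out hA hY ⟨hX, hXY.le⟩

lemma calL_inorm_le {n : ℕ} {ξ : Fin (n + 1) → ℝ} {S : Set (Fin (n + 1) → ℤ)}
    {x : Fin (n + 1) → ℤ} (hx : x ∈ S) (h0 : x ≠ 0) :
    calL ξ S (inorm x) ≤ ENNReal.ofReal (Lxi ξ x) :=
  sInf_le ⟨x, hx, h0, le_rfl, rfl⟩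

lemma IsMinimalSeq.Lxi_le_calL {n : ℕ} {ξ : Fin (n + 1) → ℝ} {S : Set (Fin (n + 1) → ℤ)}
    {x : ℕ → Fin (n + 1) → ℤ} (hx : IsMinimalSeq ξ S x) {i : ℕ} {X : ℝ}
    (hX : X < inorm (x (i + 1))) : ENNReal.ofReal (Lxi ξ (x i)) ≤ calL ξ S X := by
  refine le_sInf ?_
  rintro _ ⟨z, hz, hz0, hzX, rfl⟩
  exact ENNReal.ofReal_le_ofReal (hx.2.2.2 i z hz hz0 (hzX.trans_lt hX))

lemma IsMinimalSeq.Lxi_le_of_calL_le {n : ℕ} {ξ : Fin (n + 1) → ℝ}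
    {S : Set (Fin (n + 1) → ℤ)} {x : ℕ → Fin (n + 1) → ℤ} (hx : IsMinimalSeq ξ S x)
    {A : ℝ} {φ : ℝ → ℝ} (hcont : ContinuousOn φ (Set.Ici A)) (hpos : ∀ X, A ≤ X → 0 < φ X)
    (hφ : ∀ X, A ≤ X → calL ξ S X ≤ ENNReal.ofReal (φ X)) {i : ℕ}
    (hi : A ≤ inorm (x i)) : Lxi ξ (x i) ≤ φ (inorm (x (i + 1))) := by
  have hlt : inorm (x i) < inorm (x (i + 1)) := hx.2.1 i.lt_succ_self
  have hc : ContinuousWithinAt φ (Set.Ico (inorm (x i)) (inorm (x (i + 1))))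
      (inorm (x (i + 1))) :=
    (hcont _ (hi.trans hlt.le)).mono fun X hX => hi.trans hX.1
  have : (nhdsWithin (inorm (x (i + 1)))
      (Set.Ico (inorm (x i)) (inorm (x (i + 1))))).NeBot := by
    rw [← mem_closure_iff_nhdsWithin_neBot, closure_Ico hlt.ne]
    exact ⟨hlt.le, le_rfl⟩
  refine ge_of_tendsto hc ?_
  filter_upwards [self_mem_nhdsWithin] with X hX
  have hAX := hi.trans hX.1
  exact (ENNReal.ofReal_le_ofReal_iff (hpos X hAX).le).1
    ((hx.Lxi_le_calL hX.2).trans (hφ X hAX))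

lemma iterate_le_iterate_of_monotoneOn {I : Set ℝ} {θ : ℝ → ℝ} (hθ : MonotoneOn θ I)
    {a b : ℝ} (hab : a ≤ b) (k : ℕ) (ha : ∀ i < k, θ^[i] a ∈ I) (hb : ∀ i < k, θ^[i] b ∈ I) :
    θ^[k] a ≤ θ^[k] b := by
  induction k with
  | zero => exact hab
  | succ k ih =>
    rw [Function.iterate_succ_apply', Function.iterate_succ_apply']
    exact hθ (ha k k.lt_succ_self) (hb k k.lt_succ_self)
      (ih (fun i hi => ha i (hi.trans k.lt_succ_self)) fun i hi => hb i (hi.trans k.lt_succ_self))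

lemma PhiFun_mul_PhiFun_zero_le {I : Set ℝ} {φ θ : ℝ → ℝ} (hφpos : ∀ X ∈ I, 0 < φ X)
    (hφanti : StrictAntiOn φ I) (hθ : MonotoneOn θ I) {k : ℕ} {Y Z : ℝ} (hY0 : 0 ≤ Y)
    (hZ0 : 0 ≤ Z) (hYI : ∀ i ≤ k + 1, θ^[i] Y ∈ I) (hZI : ∀ i ≤ k, θ^[i] Z ∈ I)
    (hYZ : θ Y ≤ Z) :
    PhiFun φ θ k Z * PhiFun φ θ 0 Y ≤ Z * PhiFun φ θ (k + 1) Y := by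
  have hprod : ∏ i ∈ Finset.range (k + 1), φ (θ^[i] Z) ≤
      ∏ i ∈ Finset.range (k + 1), φ (θ^[i + 1] Y) := by
    refine Finset.prod_le_prod (fun i hi => ?_) fun i hi => ?_ <;>
      have hik : i ≤ k := Nat.lt_succ_iff.1 (Finset.mem_range.1 hi)
    · exact (hφpos _ (hZI i hik)).le
    · refine hφanti.antitoneOn (hYI (i + 1) (by omega)) (hZI i hik) ?_
      exact iterate_le_iterate_of_monotoneOn hθ hYZ i
        (fun l hl => hYI (l + 1) (by omega)) fun l hl => hZI l (by omega)
  have hφY : 0 < φ Y := hφpos _ (hYI 0 (Nat.zero_le _))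
  unfold PhiFun
  rw [Finset.prod_range_succ' _ (k + 1)]
  simp only [zero_add, Finset.prod_range_one, Function.iterate_zero, id]
  calc Z * (∏ i ∈ Finset.range (k + 1), φ (θ^[i] Z)) * (Y * φ Y)
      ≤ Z * (∏ i ∈ Finset.range (k + 1), φ (θ^[i + 1] Y)) * (Y * φ Y) := by gcongr
    _ = _ := by ring


/-- Lemma 4.1: under the hypotheses of the functional transference theorem, if
`Φ_0, …, Φ_{m−2}` are monotonically increasing for some `2 ≤ m ≤ n`, then for all indices
`k₀ ≤ j_0 < j_1 < ⋯ < j_{m−1}` one has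
`Φ_0(X_{j_0+1}) ⋯ Φ_0(X_{j_{m−1}+1}) ≤ X_{j_1} ⋯ X_{j_{m−1}} Φ_{m−1}(X_{j_{m−1}+1})`. -/
theorem intermediate_product_lemma (n : ℕ) (hn : 2 ≤ n) (ξ : Fin (n + 1) → ℝ)
    (hξ : LinearIndependent ℚ ξ) (S : Set (Fin (n + 1) → ℤ)) (I : Set ℝ)
    (hIsub : I ⊆ Set.Ioi 0) (hIconn : I.OrdConnected) (hIunb : ¬ BddAbove I)
    (A : ℝ) (hA : A ∈ I) (φ ψ θ : ℝ → ℝ)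
    (hφcont : ContinuousOn φ I) (hψcont : ContinuousOn ψ I) (hθcont : ContinuousOn θ I)
    (hφpos : ∀ X ∈ I, 0 < φ X) (hψpos : ∀ X ∈ I, 0 < ψ X) (hθpos : ∀ X ∈ I, 0 < θ X)
    (hsandwich : ∀ X : ℝ, A ≤ X →
      ENNReal.ofReal (ψ X) ≤ calL ξ S X ∧ calL ξ S X ≤ ENNReal.ofReal (φ X))
    (hφanti : StrictAntiOn φ I) (hψanti : StrictAntiOn ψ I) (hθmono : MonotoneOn θ I)
    (hφlim : Filter.Tendsto φ Filter.atTop (nhds 0))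
    (hψlim : Filter.Tendsto ψ Filter.atTop (nhds 0))
    (hθlim : Filter.Tendsto θ Filter.atTop Filter.atTop)
    (hiter : ∀ k : ℕ, 1 ≤ k → k ≤ n - 1 → ∀ X : ℝ, A ≤ X → θ^[k] X ∈ I)
    (hfuneq : ∀ X : ℝ, A ≤ X → φ X = ψ (θ X))
    (hPhi0 : MonotoneOn (PhiFun φ θ 0) (Set.Ici A))
    (hPhiMono : ∀ k : ℕ, 1 ≤ k → k ≤ n - 1 →
      MonotoneOn (PhiFun φ θ k) (Set.Ici A) ∨ AntitoneOn (PhiFun φ θ k) (Set.Ici A))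
    (x : ℕ → Fin (n + 1) → ℤ) (hx : IsMinimalSeq ξ S x)
    (k₀ : ℕ) (hk₀ : A ≤ inorm (x k₀))
    (m : ℕ) (hm2 : 2 ≤ m) (hmn : m ≤ n)
    (hmono : ∀ k : ℕ, k + 2 ≤ m → MonotoneOn (PhiFun φ θ k) (Set.Ici A))
    (j : ℕ → ℕ) (hj0 : k₀ ≤ j 0)
    (hjmono : ∀ l : ℕ, l + 1 ≤ m - 1 → j l < j (l + 1)) :
    ∏ l ∈ Finset.range m, PhiFun φ θ 0 (inorm (x (j l + 1))) ≤
      (∏ l ∈ Finset.Icc 1 (m - 1), inorm (x (j l))) *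
        PhiFun φ θ (m - 1) (inorm (x (j (m - 1) + 1))) := by
  have hIci : Set.Ici A ⊆ I := hIconn.Ici_subset_of_not_bddAbove hIunb hA
  have hX : ∀ i, k₀ ≤ i → A ≤ inorm (x i) := fun i hi => hk₀.trans (hx.2.1.monotone hi)
  have hnonneg : ∀ X, A ≤ X → 0 ≤ X := fun X h => (Set.mem_Ioi.1 (hIsub (hIci h))).le
  have hiterI : ∀ k ≤ n - 1, ∀ X, A ≤ X → θ^[k] X ∈ I := by
    intro k hk X hAX
    rcases Nat.eq_zero_or_pos k with rfl | hk0
    · exact hIci hAX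
    · exact hiter k hk0 hk X hAX
  have hθ : ∀ i, k₀ ≤ i → θ (inorm (x (i + 1))) ≤ inorm (x i) := by
    intro i hi
    have hAi := hX i hi
    have hAi' := hX (i + 1) (by omega)
    have h1 : ψ (inorm (x i)) ≤ Lxi ξ (x i) :=
      (ENNReal.ofReal_le_ofReal_iff (Lxi_nonneg _ _)).1
        ((hsandwich _ hAi).1.trans (calL_inorm_le (hx.1 i).1 (hx.1 i).2))
    have h2 := hx.Lxi_le_of_calL_le (hφcont.mono hIci) (fun X h => hφpos X (hIci h))
      (fun X h => (hsandwich X h).2) hAi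
    rw [hfuneq _ hAi'] at h2
    exact (hψanti.le_iff_ge (hIci hAi) (hiterI 1 (by omega) _ hAi')).1 (h1.trans h2)
  have hj : ∀ l ≤ m - 1, k₀ ≤ j l := by
    intro l
    induction l with
    | zero => exact fun _ => hj0
    | succ l ih =>
      intro hl
      exact (ih (by omega)).trans (hjmono l hl).le
  have key : ∀ k ≤ m - 1, ∏ l ∈ Finset.range (k + 1), PhiFun φ θ 0 (inorm (x (j l + 1))) ≤
      (∏ l ∈ Finset.Icc 1 k, inorm (x (j l))) * PhiFun φ θ k (inorm (x (j k + 1))) := by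
    intro k
    induction k with
    | zero => simp
    | succ k ih =>
      intro hk
      have hZ := hX _ (hj (k + 1) hk)
      have hY := hX (j (k + 1) + 1) ((hj (k + 1) hk).trans (Nat.le_succ _))
      have hY' := hX (j k + 1) ((hj k (by omega)).trans (Nat.le_succ _))
      have hPhi0 : 0 ≤ PhiFun φ θ 0 (inorm (x (j (k + 1) + 1))) := by
        simpa [PhiFun] using mul_nonneg (hnonneg _ hY) (hφpos _ (hIci hY)).le
      have hprod : 0 ≤ ∏ l ∈ Finset.Icc 1 k, inorm (x (j l)) :=
        Finset.prod_nonneg fun _ _ => Real.sqrt_nonneg _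
      have hstep := hmono k (by omega) hY' hZ (hx.2.1.monotone (hjmono k hk))
      have hmul := PhiFun_mul_PhiFun_zero_le (k := k) hφpos hφanti hθmono (hnonneg _ hY)
        (hnonneg _ hZ) (fun i hi => hiterI i (by omega) _ hY)
        (fun i hi => hiterI i (by omega) _ hZ) (hθ _ (hj (k + 1) hk))
      rw [Finset.prod_range_succ, Finset.prod_Icc_succ_top (by omega), mul_assoc]
      refine (mul_le_mul_of_nonneg_right
        ((ih (by omega)).trans (mul_le_mul_of_nonneg_left hstep hprod)) hPhi0).trans ?_
      rw [mul_assoc]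
      exact mul_le_mul_of_nonneg_left hmul hprod
  have := key (m - 1) le_rfl
  rwa [Nat.sub_add_cancel (by omega)] at this
end

section
/- Let n ≥ 2 be an integer, let ξ ∈ ℝ^{n+1} have ℚ-linearly independent coordinates, let S ⊆ ℤ^{n+1} satisfy lim_{X→∞} 𝓛_ξ(X;S) = 0, and let (x_i)_{i≥0} be a sequence of minimal points for ξ with respect to S. Fix an index i_0 ≥ 0 and, for t = 1,…,n−1, let i_t be the largest integer ≥ i_0 with dim span_ℝ(x_{i_0},…,x_{i_t}) = t+1 (such i_t exist and i_0 < i_1 < ⋯ < i_{n−1}). Then: (1) x_{i_t+1} ∉ span_ℝ(x_{i_0},…,x_{i_t}) for every t = 0,…,n−1; (2) span_ℝ(x_{i_0}, x_{i_0+1}, …, x_{i_{n−1}}, x_{i_{n−1}+1}) = ℝ^{n+1}; and (3) span_ℝ(x_{i_0},…,x_{i_{t−1}}, x_{i_{t−1}+1}) = span_ℝ(x_{i_0},…,x_{i_t}) for every t = 1,…,n−1, where in each case the span is of all points x_j with j ranging over the indicated consecutive range. -/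
open Filter

/-- The real vector associated with an integer point. -/
def rvec {n : ℕ} (x : Fin (n + 1) → ℤ) : Fin (n + 1) → ℝ := fun k => (x k : ℝ)

/-- `𝒱[i,j] = span_ℝ(x_i, x_{i+1}, …, x_j)`. -/
def Vspan {n : ℕ} (x : ℕ → Fin (n + 1) → ℤ) (i j : ℕ) : Submodule ℝ (Fin (n + 1) → ℝ) :=
  Submodule.span ℝ ((fun m => rvec (x m)) '' Set.Icc i j)

lemma Vspan_self {n : ℕ} (x : ℕ → Fin (n + 1) → ℤ) (i : ℕ) :
    Vspan x i i = Submodule.span ℝ {rvec (x i)} := by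
  simp [Vspan]

lemma Vspan_succ {n : ℕ} (x : ℕ → Fin (n + 1) → ℤ) {i j : ℕ} (hij : i ≤ j) :
    Vspan x i (j + 1) = Vspan x i j ⊔ Submodule.span ℝ {rvec (x (j + 1))} := by
  have h : Set.Icc i (j + 1) = Set.Icc i j ∪ {j + 1} := by
    ext m
    simp only [Set.mem_Icc, Set.mem_union, Set.mem_singleton_iff]
    omega
  rw [Vspan, h, Set.image_union, Submodule.span_union, Set.image_singleton, Vspan]

lemma Vspan_mono {n : ℕ} (x : ℕ → Fin (n + 1) → ℤ) {i j k : ℕ} (hjk : j ≤ k) :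
    Vspan x i j ≤ Vspan x i k :=
  Submodule.span_mono (Set.image_mono (Set.Icc_subset_Icc_right hjk))

lemma finrank_Vspan_succ {n : ℕ} (x : ℕ → Fin (n + 1) → ℤ) {i j : ℕ} (hij : i ≤ j)
    (hj : rvec (x (j + 1)) ∉ Vspan x i j) :
    Module.finrank ℝ (Vspan x i (j + 1)) = Module.finrank ℝ (Vspan x i j) + 1 := by
  rw [Vspan_succ x hij]
  exact Submodule.finrank_sup_span_singleton hj

lemma rvec_ne_zero {n : ℕ} {x : Fin (n + 1) → ℤ} (hx : x ≠ 0) : rvec x ≠ 0 := by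
  intro h
  apply hx
  funext k
  simpa [rvec] using congrFun h k

lemma inorm_of_rvec_eq_smul {n : ℕ} {x y : Fin (n + 1) → ℤ} {c : ℝ}
    (h : rvec y = c • rvec x) : inorm y = |c| * inorm x := by
  have hk (k) : (y k : ℝ) = c * x k := congrFun h k
  simp only [inorm, hk, mul_pow, ← Finset.mul_sum]
  rw [Real.sqrt_mul (sq_nonneg c), Real.sqrt_sq_eq_abs]

/-- One inequality of the homogeneity of `L_ξ`. -/
lemma abs_mul_Lxi_le_of_rvec_eq_smul {n : ℕ} (ξ : Fin (n + 1) → ℝ) {x y : Fin (n + 1) → ℤ}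
    {c : ℝ} (h : rvec y = c • rvec x) : |c| * Lxi ξ x ≤ Lxi ξ y := by
  have hk (k) : (y k : ℝ) = c * x k := congrFun h k
  obtain ⟨k, -, hmax⟩ := Finset.exists_mem_eq_sup' Finset.univ_nonempty
    fun k => |ξ 0 * (x k : ℝ) - ξ k * (x 0 : ℝ)|
  rw [Lxi, hmax, ← abs_mul]
  refine le_of_eq_of_le ?_ (Finset.le_sup' (fun k => |ξ 0 * (y k : ℝ) - ξ k * (y 0 : ℝ)|)
    (Finset.mem_univ k))
  simp only [hk]
  ring_nf

/-- Consecutive minimal points are linearly independent. -/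
lemma IsMinimalSeq.rvec_succ_notMem_span {n : ℕ} {ξ : Fin (n + 1) → ℝ}
    {S : Set (Fin (n + 1) → ℤ)} {x : ℕ → Fin (n + 1) → ℤ} (hx : IsMinimalSeq ξ S x) (i : ℕ) :
    rvec (x (i + 1)) ∉ Submodule.span ℝ {rvec (x i)} := by
  intro hmem
  obtain ⟨c, hc⟩ := Submodule.mem_span_singleton.1 hmem
  obtain ⟨-, hnorm, hL, -⟩ := hx
  have hnorm_lt : inorm (x i) < inorm (x (i + 1)) := hnorm i.lt_succ_self
  have hL_lt : Lxi ξ (x (i + 1)) < Lxi ξ (x i) := hL i.lt_succ_self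
  rw [inorm_of_rvec_eq_smul hc.symm] at hnorm_lt
  have hc1 : 1 < |c| := by
    by_contra! hle
    exact hnorm_lt.not_ge (mul_le_of_le_one_left (Real.sqrt_nonneg _) hle)
  have := abs_mul_Lxi_le_of_rvec_eq_smul ξ hc.symm
  have := le_mul_of_one_le_left (Lxi_nonneg ξ (x i)) hc1.le
  linarith

/-- Relations (3.1): with `i₀ < i₁ < ⋯ < i_{n−1}` the indices of Theorem 3.1, one has
`x_{i_t+1} ∉ 𝒱[i₀, i_t]` for `0 ≤ t ≤ n−1`, `𝒱[i₀, i_{n−1}+1] = ℝ^{n+1}`, and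
`𝒱[i₀, i_{t−1}+1] = 𝒱[i₀, i_t]` for `1 ≤ t ≤ n−1`. -/
theorem span_relations (n : ℕ) (hn : 2 ≤ n) (ξ : Fin (n + 1) → ℝ)
    (hξ : LinearIndependent ℚ ξ) (S : Set (Fin (n + 1) → ℤ))
    (hlim : Filter.Tendsto (calL ξ S) Filter.atTop (nhds 0))
    (x : ℕ → Fin (n + 1) → ℤ) (hx : IsMinimalSeq ξ S x)
    (i₀ : ℕ) (idx : ℕ → ℕ) (hidx0 : idx 0 = i₀)
    (hidx : ∀ t : ℕ, 1 ≤ t → t ≤ n - 1 →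
      i₀ ≤ idx t ∧
      Module.finrank ℝ ↥(Vspan x i₀ (idx t)) = t + 1 ∧
      ∀ j : ℕ, i₀ ≤ j → Module.finrank ℝ ↥(Vspan x i₀ j) = t + 1 → j ≤ idx t) :
    (∀ t : ℕ, t ≤ n - 1 → rvec (x (idx t + 1)) ∉ Vspan x i₀ (idx t)) ∧
    Vspan x i₀ (idx (n - 1) + 1) = ⊤ ∧
    (∀ t : ℕ, 1 ≤ t → t ≤ n - 1 → Vspan x i₀ (idx (t - 1) + 1) = Vspan x i₀ (idx t)) := by
  have hfin : ∀ t ≤ n - 1, i₀ ≤ idx t ∧ Module.finrank ℝ (Vspan x i₀ (idx t)) = t + 1 := by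
    intro t ht
    rcases Nat.eq_zero_or_pos t with rfl | hpos
    · rw [hidx0, Vspan_self, finrank_span_singleton (rvec_ne_zero (hx.1 i₀).2)]
      exact ⟨le_rfl, rfl⟩
    · exact ⟨(hidx t hpos ht).1, (hidx t hpos ht).2.1⟩
  have hnotMem : ∀ t ≤ n - 1, rvec (x (idx t + 1)) ∉ Vspan x i₀ (idx t) := by
    intro t ht
    rcases Nat.eq_zero_or_pos t with rfl | hpos
    · rw [hidx0, Vspan_self]
      exact hx.rvec_succ_notMem_span i₀
    · intro hmem
      obtain ⟨hle, hrank, hmax⟩ := hidx t hpos ht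
      have hV : Vspan x i₀ (idx t + 1) = Vspan x i₀ (idx t) := by
        rw [Vspan_succ x hle, sup_eq_left]
        exact (Submodule.span_singleton_le_iff_mem _ _).2 hmem
      have := hmax (idx t + 1) (by omega) (by rw [hV, hrank])
      omega
  have hrank_succ : ∀ t ≤ n - 1, Module.finrank ℝ (Vspan x i₀ (idx t + 1)) = t + 2 := by
    intro t ht
    rw [finrank_Vspan_succ x (hfin t ht).1 (hnotMem t ht), (hfin t ht).2]
  refine ⟨hnotMem, ?_, fun t hpos ht => ?_⟩
  · apply Submodule.eq_top_of_finrank_eq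
    rw [hrank_succ (n - 1) le_rfl, Module.finrank_fin_fun]
    omega
  · obtain ⟨-, hrank, hmax⟩ := hidx t hpos ht
    have hprev : Module.finrank ℝ (Vspan x i₀ (idx (t - 1) + 1)) = t + 1 := by
      rw [hrank_succ (t - 1) (by omega)]
      omega
    have hle := hmax (idx (t - 1) + 1) (by have := (hfin (t - 1) (by omega)).1; omega) hprev
    exact Submodule.eq_of_le_of_finrank_eq (Vspan_mono x hle) (hprev.trans hrank.symm)
end
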